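/- Let F=(A,R) be a finite argumentation framework with |A| = n, a ∈ A, and let F' be the copies framework with copy set C_a. If S is admissible in F with a ∈ S, then for every a_i ∈ C_a the set (S ∖ {a}) ∪ {a_i} is admissible in F'. In particular, if every admissible set of F contains a and some admissible set of F is non-empty, then every a_i ∈ C_a with i ≥ 2 belongs to some admissible set of F' and fails to belong to some admissible set of F', i.e., every such copy is an admissible-facet of F'. -/

import Mathlib

def conflictFree {α : Type*} (A : Set α) (R : Set (α × α)) (E : Set α) : Prop :=
  E ⊆ A ∧ ∀ x ∈ E, ∀ y ∈ E, (x, y) ∉ R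

def defended {α : Type*} (R : Set (α × α)) (E : Set α) (x : α) : Prop :=
  ∀ y, (y, x) ∈ R → ∃ z ∈ E, (z, y) ∈ R

def admissible {α : Type*} (A : Set α) (R : Set (α × α)) (E : Set α) : Prop :=
  conflictFree A R E ∧ ∀ x ∈ E, defended R E x

def stable {α : Type*} (A : Set α) (R : Set (α × α)) (E : Set α) : Prop :=
  conflictFree A R E ∧ ∀ x ∈ A, x ∉ E → ∃ y ∈ E, (y, x) ∈ R

def naive {α : Type*} (A : Set α) (R : Set (α × α)) (E : Set α) : Prop :=
  conflictFree A R E ∧ ∀ E', E ⊂ E' → ¬ conflictFree A R E'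

def preferred {α : Type*} (A : Set α) (R : Set (α × α)) (E : Set α) : Prop :=
  admissible A R E ∧ ∀ E', E ⊂ E' → ¬ admissible A R E'

def complete {α : Type*} (A : Set α) (R : Set (α × α)) (E : Set α) : Prop :=
  admissible A R E ∧ ∀ x ∈ A, defended R E x → x ∈ E

def credAccepted {α : Type*} (σ : Set α → Prop) (x : α) : Prop :=
  ∃ E, σ E ∧ x ∈ E

def isFacet {α : Type*} (σ : Set α → Prop) (x : α) : Prop :=
  (∃ E, σ E ∧ x ∈ E) ∧ ¬ ∀ E, σ E → x ∈ E

/-- The attack relation of the copies framework: every copy `c i` of `a`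
inherits all incoming and outgoing attacks of `a`. -/
def copiesR {α : Type*} {n : ℕ} (R : Set (α × α)) (a : α) (c : Fin n → α) : Set (α × α) :=
  {p | p ∈ R ∨ (∃ i : Fin n, ∃ x, (a, x) ∈ R ∧ p = (c i, x)) ∨
       (∃ i : Fin n, ∃ x, (x, a) ∈ R ∧ p = (x, c i))}

/-- If `S` is admissible in `F` with `a ∈ S`, then for every copy `c i` the set
`(S \ {a}) ∪ {c i}` is admissible in `F'`. In particular, if every admissible set
of `F` contains `a` and some admissible set of `F` is non-empty, then every copy
`c i` with `i ≠ 0` is an admissible-facet of `F'`. -/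
theorem copies_admissible_swap {α : Type*} (A : Set α) (hA : A.Finite)
    (R : Set (α × α)) (hR : R ⊆ A ×ˢ A) (a : α) (ha : a ∈ A)
    (n : ℕ) (hn : A.ncard = n) (hpos : 0 < n)
    (c : Fin n → α) (hinj : Function.Injective c) (hc0 : c ⟨0, hpos⟩ = a)
    (hfresh : ∀ i : Fin n, i ≠ ⟨0, hpos⟩ → c i ∉ A) :
    (∀ S : Set α, admissible A R S → a ∈ S →
      ∀ i : Fin n, admissible (A ∪ Set.range c) (copiesR R a c) ((S \ {a}) ∪ {c i})) ∧
    ((∀ S : Set α, admissible A R S → a ∈ S) →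
      (∃ S : Set α, admissible A R S ∧ S.Nonempty) →
      ∀ i : Fin n, i ≠ ⟨0, hpos⟩ →
        (∃ S', admissible (A ∪ Set.range c) (copiesR R a c) S' ∧ c i ∈ S') ∧
        (∃ S', admissible (A ∪ Set.range c) (copiesR R a c) S' ∧ c i ∉ S')) := by
  have hcA : ∀ j, c j ∈ A → c j = a := by
    intro j hj
    by_cases h : j = ⟨0, hpos⟩
    · rw [h, hc0]
    · exact absurd hj (hfresh j h)
  have main : ∀ S : Set α, admissible A R S → a ∈ S →
      ∀ i : Fin n, admissible (A ∪ Set.range c) (copiesR R a c) ((S \ {a}) ∪ {c i}) := by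
    intro S hS haS i
    obtain ⟨⟨hSA, hcf⟩, hdef⟩ := hS
    -- projection relation
    let P : α → α → Prop := fun x x' => (x = x' ∧ x ∈ A) ∨ ((∃ j, x = c j) ∧ x' = a)
    have hPuniq : ∀ x u v, P x u → P x v → u = v := by
      rintro x u v (⟨rfl, h1⟩ | ⟨⟨j, rfl⟩, rfl⟩) (⟨rfl, h2⟩ | ⟨⟨k, hk⟩, rfl⟩)
      · rfl
      · subst hk; exact hcA k h1
      · exact (hcA j h2).symm
      · rfl
    have hproj : ∀ x y, (x, y) ∈ copiesR R a c → ∃ x' y', P x x' ∧ P y y' ∧ (x', y') ∈ R := by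
      rintro x y (h | ⟨j, z, h, he⟩ | ⟨j, z, h, he⟩)
      · exact ⟨x, y, Or.inl ⟨rfl, (hR h).1⟩, Or.inl ⟨rfl, (hR h).2⟩, h⟩
      · obtain ⟨rfl, rfl⟩ := Prod.mk.inj he
        exact ⟨a, y, Or.inr ⟨⟨j, rfl⟩, rfl⟩, Or.inl ⟨rfl, (hR h).2⟩, h⟩
      · obtain ⟨rfl, rfl⟩ := Prod.mk.inj he
        exact ⟨x, a, Or.inl ⟨rfl, (hR h).1⟩, Or.inr ⟨⟨j, rfl⟩, rfl⟩, h⟩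
    have hE : ∀ x ∈ (S \ {a}) ∪ {c i}, ∀ x', P x x' → x' ∈ S := by
      rintro x (hx | hx) x' hP
      · have := hPuniq x x' x hP (Or.inl ⟨rfl, hSA hx.1⟩)
        rw [this]; exact hx.1
      · have := hPuniq x x' a hP (Or.inr ⟨⟨i, hx⟩, rfl⟩)
        rw [this]; exact haS
    refine ⟨⟨?_, ?_⟩, ?_⟩
    · rintro x (hx | hx)
      · exact Or.inl (hSA hx.1)
      · exact Or.inr ⟨i, hx.symm⟩
    · intro x hx y hy hxy
      obtain ⟨x', y', h1, h2, h3⟩ := hproj x y hxy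
      exact hcf x' (hE x hx x' h1) y' (hE y hy y' h2) h3
    · intro x hx y hyx
      obtain ⟨y', x', h1, h2, h3⟩ := hproj y x hyx
      obtain ⟨z, hz, hzy⟩ := hdef x' (hE x hx x' h2) y' h3
      by_cases hza : z = a
      · subst hza
        refine ⟨c i, Or.inr rfl, ?_⟩
        rcases h1 with ⟨rfl, _⟩ | ⟨_, rfl⟩
        · exact Or.inr (Or.inl ⟨i, y, hzy, rfl⟩)
        · exact absurd hzy (hcf _ hz _ hz)
      · refine ⟨z, Or.inl ⟨hz, hza⟩, ?_⟩
        rcases h1 with ⟨rfl, _⟩ | ⟨⟨j, rfl⟩, rfl⟩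
        · exact Or.inl hzy
        · exact Or.inr (Or.inr ⟨j, z, hzy, rfl⟩)
  refine ⟨main, ?_⟩
  rintro hall ⟨S, hS, _⟩ i _
  refine ⟨⟨_, main S hS (hall S hS) i, Or.inr rfl⟩, ⟨∅, ⟨⟨Set.empty_subset _, ?_⟩, ?_⟩, ?_⟩⟩
  · intro x hx; exact hx.elim
  · intro x hx; exact hx.elim
  · exact fun h => h
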